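/- Fix θ > 0 and functions σ : (0,∞) → (0,∞) and γ : (0,∞) → (0,∞). For δ > 0 put α = γ(δ)·√(coth δ), β = γ(δ)⁻¹·√(coth δ), N_δ(t,ω) = (θ²/(2π))·cosh δ · exp(t²/α² + ω²/β²), and ν(δ) = σ(δ)²/(2π). Define S(δ) = Σ_{k=0}^∞ max(0, σ(δ)² − θ² e^{(2k+1)δ}) and C(δ) = Σ_{k=0}^∞ max(0, (1/2)·ln(σ(δ)²/(θ² e^{(2k+1)δ}))). If δ·S(δ) stays bounded as δ → 0+, then both (C(δ) − (1/(2π))·∬_{ℝ²} (1/2)·ln(1 + max(0, ν(δ) − N_δ(t,ω))/N_δ(t,ω)) dt dω)/coth δ → 0 and (S(δ) − ∬_{ℝ²} max(0, ν(δ) − N_δ(t,ω)) dt dω)/coth δ → 0 as δ → 0+. -/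

import Mathlib

open Real Filter Set MeasureTheory

theorem polar_int (G : ℝ → ℝ) : ∫ p : ℝ × ℝ, G (p.1 ^ 2 + p.2 ^ 2) = π * ∫ x in Ioi (0:ℝ), G x := by
  rw [← integral_comp_polarCoord_symm]
  have h1 : ∀ p : ℝ × ℝ, p.1 • G ((polarCoord.symm p).1 ^ 2 + (polarCoord.symm p).2 ^ 2)
      = (p.1 * G (p.1 ^ 2)) * (fun _ => (1:ℝ)) p.2 := by
    intro p
    have : (polarCoord.symm p).1 ^ 2 + (polarCoord.symm p).2 ^ 2 = p.1 ^ 2 := by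
      simp only [polarCoord_symm_apply]
      nlinarith [Real.sin_sq_add_cos_sq p.2]
    rw [this]; simp
  simp_rw [h1]
  rw [polarCoord_target, Measure.volume_eq_prod, setIntegral_prod_mul (fun r : ℝ => r * G (r ^ 2)) (fun _ => (1:ℝ))]
  rw [← integral_comp_rpow_Ioi G (p := 2) (by norm_num)]
  have h2 : ∀ x : ℝ, (|(2:ℝ)| * x ^ ((2:ℝ) - 1)) • G (x ^ (2:ℝ)) = 2 * (x * G (x ^ 2)) := by
    intro x
    rw [abs_of_pos (by norm_num : (0:ℝ) < 2)]
    norm_num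
    ring
  simp_rw [h2, integral_const_mul]
  simp
  rw [max_eq_left (by positivity)]
  ring

theorem ellip_int (G : ℝ → ℝ) (hG : Continuous G) (a b : ℝ) (ha : 0 < a) (hb : 0 < b) :
    ∫ p : ℝ × ℝ, G (p.1 ^ 2 / a ^ 2 + p.2 ^ 2 / b ^ 2) = a * b * (π * ∫ x in Ioi (0:ℝ), G x) := by
  rw [← polar_int]
  let f : ℝ × ℝ →ₗ[ℝ] ℝ × ℝ := LinearMap.prodMap (a⁻¹ • LinearMap.id) (b⁻¹ • LinearMap.id)
  have hd : LinearMap.det f = a⁻¹ * b⁻¹ := by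
    simp [f, LinearMap.det_prodMap]
  have hm := Measure.map_linearMap_addHaar_eq_smul_addHaar (volume : Measure (ℝ × ℝ)) (f := f)
    (by rw [hd]; positivity)
  have hfm : Measurable f := f.continuous_of_finiteDimensional.measurable
  have h := MeasureTheory.integral_map (μ := (volume : Measure (ℝ × ℝ))) hfm.aemeasurable
    (f := fun p : ℝ × ℝ => G (p.1 ^ 2 + p.2 ^ 2))
    (by apply Continuous.aestronglyMeasurable; fun_prop)
  rw [hm, hd, integral_smul_measure] at h
  rw [abs_of_pos (by positivity), ENNReal.toReal_ofReal (by positivity)] at h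
  simp only [mul_inv, inv_inv, smul_eq_mul] at h
  rw [h]
  congr 1
  ext p
  simp [f, mul_pow]
  congr 1
  ring

theorem sum_bounds (f : ℝ → ℝ) (hf : Antitone f) (X : ℝ)
    (hX : ∀ x, X ≤ x → f x = 0) (δ : ℝ) (hδ : 0 < δ) :
    (∫ x in δ..X, f x) ≤ 2 * δ * ∑' k : ℕ, f ((2 * (k:ℝ) + 1) * δ) ∧
    2 * δ * ∑' k : ℕ, f ((2 * (k:ℝ) + 1) * δ) ≤ ∫ x in (-δ)..X, f x := by
  have hi : ∀ a b : ℝ, IntervalIntegrable f volume a b := fun a b => hf.intervalIntegrable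
  obtain ⟨n, hn⟩ := exists_nat_gt ((X + δ) / (2 * δ))
  have hn' : X + δ < n * (2 * δ) := by
    rwa [div_lt_iff₀ (by positivity)] at hn
  have hts : ∑' k : ℕ, f ((2 * (k:ℝ) + 1) * δ) = ∑ k ∈ Finset.range n, f ((2 * (k:ℝ) + 1) * δ) := by
    apply tsum_eq_sum
    intro k hk
    apply hX
    have : n ≤ k := by simpa using hk
    have : (n:ℝ) ≤ k := by exact_mod_cast this
    nlinarith
  have hzero : ∀ b, X ≤ b → ∫ x in X..b, f x = 0 := by
    intro b hb
    apply intervalIntegral.integral_zero_ae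
    filter_upwards with x hx
    rw [uIoc_of_le hb] at hx
    exact hX x hx.1.le
  have hg : Antitone (fun y => f (2 * δ * y)) := fun x y hxy =>
    hf (by apply mul_le_mul_of_nonneg_left hxy; positivity)
  have e1 := (hg.antitoneOn (Icc (1/2:ℝ) (1/2 + n))).integral_le_sum
  have e2 := (hg.antitoneOn (Icc (-1/2:ℝ) (-1/2 + n))).sum_le_integral
  rw [intervalIntegral.integral_comp_mul_left _ (by positivity)] at e1 e2
  have s1 : ∑ i ∈ Finset.range n, f (2 * δ * (1/2 + i)) = ∑ k ∈ Finset.range n, f ((2 * (k:ℝ) + 1) * δ) := by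
    apply Finset.sum_congr rfl; intros; congr 1; ring
  have s2 : ∑ i ∈ Finset.range n, f (2 * δ * (-1/2 + (i + 1 : ℕ))) = ∑ k ∈ Finset.range n, f ((2 * (k:ℝ) + 1) * δ) := by
    apply Finset.sum_congr rfl; intros; congr 1; push_cast; ring
  rw [s1] at e1
  rw [s2] at e2
  rw [hts]
  rw [smul_eq_mul, inv_mul_le_iff₀ (by positivity)] at e1
  rw [smul_eq_mul, ← div_eq_inv_mul, le_div_iff₀' (by positivity)] at e2
  have a1 : 2 * δ * (1/2) = δ := by ring
  have a2 : 2 * δ * (-1/2) = -δ := by ring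
  rw [a1] at e1
  rw [a2] at e2
  rw [← intervalIntegral.integral_add_adjacent_intervals (hi _ X) (hi X _), hzero _ (by nlinarith)] at e1 e2
  constructor <;> linarith

theorem J_eq (f : ℝ → ℝ) (X : ℝ) (hX1 : 0 ≤ X) 
    (hX : ∀ x, X ≤ x → f x = 0) (l : ℝ) (hl : 0 ≤ l) (hf : Antitone f) :
    ∫ x in Ioi (0:ℝ), f (x + l) = ∫ x in l..X, f x := by
  have h1 : ∫ x in Ioi (0:ℝ), f (x + l) = ∫ x in Ioc (0:ℝ) X, f (x + l) := by
    apply setIntegral_eq_of_subset_of_forall_sdiff_eq_zero measurableSet_Ioi Ioc_subset_Ioi_self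
    rintro x ⟨hx, hx'⟩
    apply hX
    simp only [mem_Ioi, mem_Ioc, not_and, not_le] at hx hx'
    linarith [hx' hx]
  rw [h1, ← intervalIntegral.integral_of_le hX1, intervalIntegral.integral_comp_add_right]
  have hi : ∀ a b : ℝ, IntervalIntegrable f volume a b := fun a b => hf.intervalIntegrable
  rw [zero_add, ← intervalIntegral.integral_add_adjacent_intervals (hi _ X) (hi X _)]
  have : ∫ x in X..(X+l), f x = 0 := by
    apply intervalIntegral.integral_zero_ae
    filter_upwards with x hx
    rw [uIoc_of_le (by linarith)] at hx
    exact hX x hx.1.le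
  rw [this, add_zero]

theorem J_bounds (f : ℝ → ℝ) (hf : Antitone f) (h0 : ∀ x, 0 ≤ f x) (X : ℝ) (hX1 : 1 ≤ X)
    (hX : ∀ x, X ≤ x → f x = 0) (B : ℝ) (hB : f (-1) ≤ B) (δ : ℝ) (hδ : 0 < δ) (hδ1 : δ ≤ 1) :
    |2 * δ * (∑' k : ℕ, f ((2 * (k:ℝ) + 1) * δ)) - ∫ x in Ioi (0:ℝ), f (x + log (cosh δ))| ≤ 2 * δ * B ∧
    |∫ x in Ioi (0:ℝ), f (x + log (cosh δ))| ≤ (X + 1) * B := by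
  have hl0 : 0 ≤ log (cosh δ) := log_nonneg (one_le_cosh δ)
  have hl1 : log (cosh δ) ≤ δ := by
    rw [log_le_iff_le_exp (cosh_pos δ)]
    refine (cosh_le_exp_half_sq δ).trans (exp_le_exp.2 (by nlinarith))
  set l := log (cosh δ)
  obtain ⟨b1, b2⟩ := sum_bounds f hf X hX δ hδ
  rw [J_eq f X (by linarith) hX l hl0 hf]
  have hi : ∀ a b : ℝ, IntervalIntegrable f volume a b := fun a b => hf.intervalIntegrable
  have hub : ∀ a b : ℝ, -1 ≤ a → a ≤ b → ∫ x in a..b, f x ≤ (b - a) * B := by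
    intro a b ha hab
    have := intervalIntegral.integral_mono_on hab (hi a b) (intervalIntegrable_const (c := B))
      (fun x hx => (hf (ha.trans hx.1)).trans hB)
    simpa using this
  have hlb : ∀ a b : ℝ, a ≤ b → 0 ≤ ∫ x in a..b, f x := fun a b hab =>
    intervalIntegral.integral_nonneg hab (fun x _ => h0 x)
  have c1 := intervalIntegral.integral_add_adjacent_intervals (hi (-δ) l) (hi l X)
  have c2 := intervalIntegral.integral_add_adjacent_intervals (hi l δ) (hi δ X)
  have d1 := hub (-δ) l (by linarith) (by linarith)
  have d2 := hub l δ (by linarith) (by linarith)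
  have d3 := hub l X (by linarith) (by linarith)
  have d4 := hlb l X (by linarith)
  have d5 := hlb (-δ) l (by linarith)
  have d6 := hlb l δ (by linarith)
  have hB0 : 0 ≤ B := (h0 _).trans hB
  refine ⟨abs_le.2 ⟨by nlinarith, by nlinarith⟩, abs_le.2 ⟨by nlinarith, by nlinarith⟩⟩

theorem tanh_lim : Tendsto (fun δ : ℝ => (sinh δ / cosh δ) / δ) (nhdsWithin 0 (Ioi 0)) (nhds 1) := by
  have h := (Real.hasDerivAt_sinh 0).div (Real.hasDerivAt_cosh 0) (by simp)
  have h2 := (hasDerivAt_iff_tendsto_slope_zero.1 h).mono_left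
    (nhdsWithin_mono 0 (fun x (hx : 0 < x) => hx.ne'))
  simp at h2
  refine h2.congr (fun x => ?_)
  ring

theorem T_lim (f : ℝ → ℝ → ℝ) (X B : ℝ) (hX1 : 1 ≤ X)
    (hf : ∀ᶠ δ in nhdsWithin 0 (Ioi 0), Antitone (f δ) ∧ (∀ x, 0 ≤ f δ x) ∧
      (∀ x, X ≤ x → f δ x = 0) ∧ f δ (-1) ≤ B) :
    Tendsto (fun δ : ℝ => ((∑' k : ℕ, f δ ((2 * (k:ℝ) + 1) * δ)) - (cosh δ / sinh δ) / 2 *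
      ∫ x in Ioi (0:ℝ), f δ (x + log (cosh δ))) / (cosh δ / sinh δ)) (nhdsWithin 0 (Ioi 0)) (nhds 0) := by
  have hid : Tendsto (fun δ : ℝ => δ) (nhdsWithin 0 (Ioi 0)) (nhds 0) :=
    tendsto_id.mono_left nhdsWithin_le_nhds
  have hlim : Tendsto (fun δ : ℝ => |(sinh δ / cosh δ) / δ| * (δ * B) +
      1 / 2 * |(sinh δ / cosh δ) / δ - 1| * ((X + 1) * B)) (nhdsWithin 0 (Ioi 0)) (nhds 0) := by
    have := (tanh_lim.abs.mul (hid.mul_const B)).add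
      (((tanh_lim.sub_const 1).abs.const_mul (1/2)).mul_const ((X + 1) * B))
    simpa using this
  refine squeeze_zero_norm' ?_ hlim
  filter_upwards [hf, self_mem_nhdsWithin, hid.eventually_le_const (show (0:ℝ) < 1 by norm_num)]
    with δ ⟨h1, h2, h3, h4⟩ hδ hδ1
  have hδ : 0 < δ := hδ
  obtain ⟨j1, j2⟩ := J_bounds (f δ) h1 h2 X hX1 h3 B h4 δ hδ hδ1
  set T := ∑' k : ℕ, f δ ((2 * (k:ℝ) + 1) * δ)
  set J := ∫ x in Ioi (0:ℝ), f δ (x + log (cosh δ))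
  have hs : 0 < sinh δ := sinh_pos_iff.2 hδ
  have hc := cosh_pos δ
  have e : (T - (cosh δ / sinh δ) / 2 * J) / (cosh δ / sinh δ) =
      (sinh δ / cosh δ) / δ * ((2 * δ * T - J) / 2) + 1 / 2 * ((sinh δ / cosh δ) / δ - 1) * J := by
    field_simp
    ring
  rw [e, Real.norm_eq_abs]
  refine (abs_add_le _ _).trans ?_
  rw [abs_mul, abs_mul, abs_mul, abs_of_pos (by norm_num : (0:ℝ) < 1/2)]
  gcongr
  rw [abs_div, abs_of_pos (by norm_num : (0:ℝ) < 2)]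
  linarith

/-- Theorem 2 of the paper: water-filling characterization of the capacity of the heat channel
in the time–frequency plane. With `α = γ(δ)·√(coth δ)`, `β = γ(δ)⁻¹·√(coth δ)`,
`N_δ(t,ω) = (θ²/(2π))·cosh δ·exp(t²/α² + ω²/β²)`, water level `ν(δ) = σ(δ)²/(2π)`,
water-filled energy `S(δ)` and capacity `C(δ)` of the heat channel; if `δ·S(δ)` stays bounded
as `δ → 0+`, then `C ≐ (1/(2π))·∬ (1/2)·ln(1 + (ν − N)⁺/N)` and `S ≐ ∬ (ν − N)⁺`, where
`A ≐ B` means `(A − B)/coth δ → 0` as `δ → 0+`. -/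
theorem heat_channel_capacity_tf_waterfilling
    (θ : ℝ) (hθ : 0 < θ)
    (σ γ : ℝ → ℝ) (hσ : ∀ δ > 0, 0 < σ δ) (hγ : ∀ δ > 0, 0 < γ δ)
    (S C : ℝ → ℝ)
    (hS : ∀ δ > 0, S δ =
      ∑' k : ℕ, max 0 (σ δ ^ 2 - θ ^ 2 * Real.exp ((2 * (k : ℝ) + 1) * δ)))
    (hC : ∀ δ > 0, C δ =
      ∑' k : ℕ, max 0 ((1 / 2) *
        Real.log (σ δ ^ 2 / (θ ^ 2 * Real.exp ((2 * (k : ℝ) + 1) * δ)))))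
    (N : ℝ → ℝ → ℝ → ℝ)
    (hN : ∀ δ > 0, ∀ t ω : ℝ, N δ t ω =
      (θ ^ 2 / (2 * π)) * Real.cosh δ *
        Real.exp (t ^ 2 / (γ δ * Real.sqrt (Real.cosh δ / Real.sinh δ)) ^ 2 +
          ω ^ 2 / ((γ δ)⁻¹ * Real.sqrt (Real.cosh δ / Real.sinh δ)) ^ 2))
    (hbound : ∃ M : ℝ, ∀ᶠ δ in nhdsWithin 0 (Set.Ioi 0), δ * S δ ≤ M) :
    Filter.Tendsto
      (fun δ : ℝ =>
        (C δ - (1 / (2 * π)) * ∫ p : ℝ × ℝ,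
            (1 / 2) * Real.log (1 + max 0 (σ δ ^ 2 / (2 * π) - N δ p.1 p.2) / N δ p.1 p.2)) /
          (Real.cosh δ / Real.sinh δ))
      (nhdsWithin 0 (Set.Ioi 0)) (nhds 0) ∧
    Filter.Tendsto
      (fun δ : ℝ =>
        (S δ - ∫ p : ℝ × ℝ, max 0 (σ δ ^ 2 / (2 * π) - N δ p.1 p.2)) /
          (Real.cosh δ / Real.sinh δ))
      (nhdsWithin 0 (Set.Ioi 0)) (nhds 0) := by
  obtain ⟨M, hM⟩ := hbound
  have hid : Tendsto (fun δ : ℝ => δ) (nhdsWithin 0 (Ioi 0)) (nhds 0) :=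
    tendsto_id.mono_left nhdsWithin_le_nhds
  have hpos : ∀ᶠ δ : ℝ in nhdsWithin 0 (Ioi 0), 0 < δ := self_mem_nhdsWithin
  have hle1 := hid.eventually_le_const (show (0:ℝ) < 1 by norm_num)
  have ha : 0 < θ ^ 2 := by positivity
  set a := θ ^ 2 with ha_def
  have antiS : ∀ s : ℝ, Antitone (fun x => max 0 (s - a * rexp x)) := by
    intro s x y hxy
    dsimp only
    gcongr
  have antiC : ∀ s : ℝ, 0 < s → Antitone (fun x => max 0 ((1 / 2) * log (s / (a * rexp x)))) := by
    intro s hs x y hxy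
    dsimp only
    gcongr
  have zeroS : ∀ s x : ℝ, s ≤ a * rexp x → max 0 (s - a * rexp x) = 0 := by
    intro s x h
    exact max_eq_left (by linarith)
  have zeroC : ∀ s x : ℝ, 0 < s → s ≤ a * rexp x →
      max 0 ((1 / 2) * log (s / (a * rexp x))) = 0 := by
    intro s x hs h
    apply max_eq_left
    have : log (s / (a * rexp x)) ≤ 0 := by
      apply log_nonpos (by positivity)
      rw [div_le_one (by positivity)]
      exact h
    linarith
  have hlogx : ∀ s A x : ℝ, 0 < s → s ≤ A → log (A / a) ≤ x → s ≤ a * rexp x := by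
    intro s A x hs hA hx
    have hA0 : 0 < A := hs.trans_le hA
    rw [log_le_iff_le_exp (by positivity), div_le_iff₀' ha] at hx
    linarith
  -- the water level is bounded
  set A := 2 * M + a * rexp 2 with hA_def
  have hsA : ∀ᶠ δ : ℝ in nhdsWithin 0 (Ioi 0), σ δ ^ 2 ≤ A := by
    filter_upwards [hM, hpos, hle1] with δ h1 hδ hδ1
    have hs : 0 < σ δ ^ 2 := pow_pos (hσ δ hδ) 2
    set s := σ δ ^ 2 with hs_def
    have hz : ∀ x, max 2 (log (s / a)) ≤ x → max 0 (s - a * rexp x) = 0 := fun x hx =>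
      zeroS s x (hlogx s s x hs le_rfl ((le_max_right _ _).trans hx))
    have hb := (sum_bounds (fun x => max 0 (s - a * rexp x)) (antiS s)
      (max 2 (log (s / a))) hz δ hδ).1
    rw [hS δ hδ] at h1
    have hi : ∀ u v : ℝ, IntervalIntegrable (fun x => max 0 (s - a * rexp x)) volume u v :=
      fun u v => (antiS s).intervalIntegrable
    set Y := max 2 (log (s / a)) with hY
    have hY2 : 2 ≤ Y := le_max_left _ _
    have c1 := intervalIntegral.integral_add_adjacent_intervals (hi δ 1) (hi 1 Y)
    have c2 := intervalIntegral.integral_add_adjacent_intervals (hi 1 2) (hi 2 Y)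
    have d1 : 0 ≤ ∫ x in δ..1, max 0 (s - a * rexp x) :=
      intervalIntegral.integral_nonneg hδ1 (fun x _ => le_max_left _ _)
    have d2 : 0 ≤ ∫ x in (2:ℝ)..Y, max 0 (s - a * rexp x) :=
      intervalIntegral.integral_nonneg hY2 (fun x _ => le_max_left _ _)
    have d3 : s - a * rexp 2 ≤ ∫ x in (1:ℝ)..2, max 0 (s - a * rexp x) := by
      have := intervalIntegral.integral_mono_on (by norm_num : (1:ℝ) ≤ 2)
        (intervalIntegrable_const (c := s - a * rexp 2)) (hi 1 2) (fun x hx => by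
          refine le_trans ?_ (le_max_right _ _)
          have := hx.2
          gcongr)
      rw [intervalIntegral.integral_const] at this
      norm_num at this
      simpa using this
    simp only [hA_def]
    linarith
  set X := max 1 (log (A / a)) with hX_def
  have hcoth : ∀ δ : ℝ, 0 < δ → 0 < cosh δ / sinh δ := fun δ hδ =>
    div_pos (cosh_pos δ) (sinh_pos_iff.2 hδ)
  have hexp : ∀ δ x : ℝ, rexp (x + log (cosh δ)) = cosh δ * rexp x := by
    intro δ x
    rw [Real.exp_add, exp_log (cosh_pos δ), mul_comm]
  have hell : ∀ (G : ℝ → ℝ), Continuous G → ∀ δ > 0, ∫ p : ℝ × ℝ,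
      G (p.1 ^ 2 / (γ δ * √(cosh δ / sinh δ)) ^ 2 + p.2 ^ 2 / ((γ δ)⁻¹ * √(cosh δ / sinh δ)) ^ 2)
      = (cosh δ / sinh δ) * (π * ∫ x in Ioi (0:ℝ), G x) := by
    intro G hG δ hδ
    have hg := hγ δ hδ
    have hr : 0 < √(cosh δ / sinh δ) := sqrt_pos.2 (hcoth δ hδ)
    rw [ellip_int G hG _ _ (by positivity) (by positivity)]
    congr 1
    calc γ δ * √(cosh δ / sinh δ) * ((γ δ)⁻¹ * √(cosh δ / sinh δ))
        = (γ δ * (γ δ)⁻¹) * (√(cosh δ / sinh δ) * √(cosh δ / sinh δ)) := by ring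
      _ = _ := by rw [mul_inv_cancel₀ hg.ne', mul_self_sqrt (hcoth δ hδ).le, one_mul]
  constructor
  · have key := T_lim (fun δ x => max 0 ((1 / 2) * log (σ δ ^ 2 / (a * rexp x)))) X
      (max 0 ((1 / 2) * log (A / (a * rexp (-1))))) (le_max_left _ _) (by
        filter_upwards [hsA, hpos] with δ h1 hδ
        have hs : 0 < σ δ ^ 2 := pow_pos (hσ δ hδ) 2
        refine ⟨antiC _ hs, fun x => le_max_left _ _, fun x hx => ?_, ?_⟩
        · exact zeroC _ x hs (hlogx _ A x hs h1 ((le_max_right _ _).trans hx))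
        · gcongr)
    refine key.congr' ?_
    filter_upwards [hpos] with δ hδ
    have hs : 0 < σ δ ^ 2 := pow_pos (hσ δ hδ) 2
    have hc := cosh_pos δ
    rw [hC δ hδ]
    congr 2
    have hint : ∀ p : ℝ × ℝ, (1 / 2) * Real.log (1 + max 0 (σ δ ^ 2 / (2 * π) - N δ p.1 p.2) / N δ p.1 p.2)
        = (fun x => max 0 ((1 / 2) * log (σ δ ^ 2 / (a * rexp (x + log (cosh δ))))))
          (p.1 ^ 2 / (γ δ * √(cosh δ / sinh δ)) ^ 2 + p.2 ^ 2 / ((γ δ)⁻¹ * √(cosh δ / sinh δ)) ^ 2) := by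
      intro p
      rw [hN δ hδ]
      dsimp only
      rw [hexp]
      set E := rexp (p.1 ^ 2 / (γ δ * √(cosh δ / sinh δ)) ^ 2 + p.2 ^ 2 / ((γ δ)⁻¹ * √(cosh δ / sinh δ)) ^ 2)
      have hE : 0 < E := exp_pos _
      set n := a / (2 * π) * cosh δ * E with hn_def
      have hn : 0 < n := by positivity
      have hq : σ δ ^ 2 / (a * (cosh δ * E)) = (σ δ ^ 2 / (2 * π)) / n := by
        rw [hn_def]; field_simp
      rw [hq]
      set w := σ δ ^ 2 / (2 * π) with hw_def
      have hw : 0 < w := by positivity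
      rcases le_total w n with h | h
      · rw [max_eq_left (by linarith), max_eq_left]
        · simp
        · have := log_nonpos (by positivity) ((div_le_one hn).2 h)
          linarith
      · rw [max_eq_right (by linarith), max_eq_right]
        · congr 2
          field_simp
          ring
        · have := log_nonneg ((one_le_div hn).2 h)
          linarith
    rw [(integral_congr_ae (ae_of_all _ hint)).trans (hell (fun x => max 0 ((1 / 2) * log (σ δ ^ 2 / (a * rexp (x + log (cosh δ)))))) ?_ δ hδ)]
    · field_simp
    · refine continuous_const.max (continuous_const.mul ?_)
      refine Continuous.log ?_ (fun x => by positivity)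
      exact continuous_const.div (by fun_prop) (fun x => by positivity)
  · have key := T_lim (fun δ x => max 0 (σ δ ^ 2 - a * rexp x)) X A (le_max_left _ _) (by
        filter_upwards [hsA, hpos] with δ h1 hδ
        have hs : 0 < σ δ ^ 2 := pow_pos (hσ δ hδ) 2
        refine ⟨antiS _, fun x => le_max_left _ _, fun x hx => ?_, ?_⟩
        · exact zeroS _ x (hlogx _ A x hs h1 ((le_max_right _ _).trans hx))
        · apply max_le (by linarith)
          have : 0 < a * rexp (-1) := by positivity
          linarith)
    refine key.congr' ?_
    filter_upwards [hpos] with δ hδ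
    rw [hS δ hδ]
    congr 2
    have hint : ∀ p : ℝ × ℝ, max 0 (σ δ ^ 2 / (2 * π) - N δ p.1 p.2)
        = (fun x => (1 / (2 * π)) * max 0 (σ δ ^ 2 - a * rexp (x + log (cosh δ))))
          (p.1 ^ 2 / (γ δ * √(cosh δ / sinh δ)) ^ 2 + p.2 ^ 2 / ((γ δ)⁻¹ * √(cosh δ / sinh δ)) ^ 2) := by
      intro p
      rw [hN δ hδ]
      dsimp only
      rw [hexp, mul_max_of_nonneg _ _ (by positivity), mul_zero]
      congr 1
      field_simp
    rw [(integral_congr_ae (ae_of_all _ hint)).trans (hell (fun x => (1 / (2 * π)) * max 0 (σ δ ^ 2 - a * rexp (x + log (cosh δ)))) (by fun_prop) δ hδ), integral_const_mul]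
    field_simp
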